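/- Every K_4-minor-free graph of odd-girth at least 5 admits a homomorphism to the graph C_8^{++}, obtained from the cycle v₁v₂…v₈ by adding the two antipodal edges v₁v₅ and v₃v₇. -/

import Mathlib

open SimpleGraph

/-- `G` has odd-girth at least `n`: every odd cycle has length at least `n`. -/
def oddGirthAtLeast {V : Type*} (G : SimpleGraph V) (n : ℕ) : Prop :=
  ∀ (x : V) (w : G.Walk x x), w.IsCycle → Odd w.length → n ≤ w.length

/-- `G` has a `K₄` minor: there are four nonempty, pairwise disjoint, connected
branch sets with an edge of `G` between every two of them. -/
def HasK4Minor {V : Type*} (G : SimpleGraph V) : Prop :=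
  ∃ S : Fin 4 → Set V,
    (∀ i, (S i).Nonempty) ∧
    (∀ i, (G.induce (S i)).Connected) ∧
    (Pairwise fun i j => Disjoint (S i) (S j)) ∧
    (Pairwise fun i j => ∃ a ∈ S i, ∃ b ∈ S j, G.Adj a b)

/-- The graph `C₈⁺⁺`: an 8-cycle `v₁v₂…v₈` (here on `ZMod 8`, with `vᵢ = i-1`)
together with the two antipodal edges `v₁v₅` and `v₃v₇`. -/
def C8pp : SimpleGraph (ZMod 8) :=
  SimpleGraph.fromRel fun a b => b = a + 1 ∨ (a = 0 ∧ b = 4) ∨ (a = 2 ∧ b = 6)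

namespace SimpleGraph

variable {V : Type*}

/-- The graph obtained from `G` by contracting `z` into `y`; the vertex `z` remains as an
isolated vertex. -/
def contractInto (G : SimpleGraph V) (z y : V) : SimpleGraph V where
  Adj a b := a ≠ b ∧ a ≠ z ∧ b ≠ z ∧ (G.Adj a b ∨ (a = y ∧ G.Adj z b) ∨ (b = y ∧ G.Adj z a))
  symm := ⟨fun a b h => by
    obtain ⟨h1, h2, h3, h4⟩ := h
    refine ⟨h1.symm, h3, h2, ?_⟩
    rcases h4 with h | h | h
    · exact Or.inl h.symm
    · exact Or.inr (Or.inr h)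
    · exact Or.inr (Or.inl h)⟩
  loopless := ⟨fun a h => h.1 rfl⟩

theorem contractInto_adj {G : SimpleGraph V} {z y a b : V} :
    (G.contractInto z y).Adj a b ↔
      a ≠ b ∧ a ≠ z ∧ b ≠ z ∧ (G.Adj a b ∨ (a = y ∧ G.Adj z b) ∨ (b = y ∧ G.Adj z a)) :=
  Iff.rfl

theorem support_contractInto_ssubset {G : SimpleGraph V} {z y : V} (h : G.Adj z y) :
    (G.contractInto z y).support ⊂ G.support := by
  refine (Set.ssubset_iff_of_subset ?_).2 ⟨z, ⟨y, h⟩, ?_⟩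
  · rintro a ⟨b, -, -, -, hab | ⟨rfl, -⟩ | ⟨-, hza⟩⟩
    exacts [⟨b, hab⟩, ⟨z, h.symm⟩, ⟨z, hza.symm⟩]
  · rintro ⟨b, hb⟩
    exact hb.2.1 rfl

theorem HasK4Minor.mono {G H : SimpleGraph V} (hGH : G ≤ H) (h : HasK4Minor G) :
    HasK4Minor H := by
  obtain ⟨S, hne, hconn, hdisj, hadj⟩ := h
  refine ⟨S, hne, fun i => (hconn i).mono fun a b hab => hGH hab, hdisj, fun i j hij => ?_⟩
  obtain ⟨a, ha, b, hb, hab⟩ := hadj hij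
  exact ⟨a, ha, b, hb, hGH hab⟩

theorem HasK4Minor.of_contractInto {G : SimpleGraph V} {z y : V} (hzy : G.Adj z y)
    (h : HasK4Minor (G.contractInto z y)) : HasK4Minor G := by
  classical
  obtain ⟨S, -, hconn, hdisj, hadj⟩ := h
  let φ : V → V := fun v => if v = z then y else v
  have φz : φ z = y := if_pos rfl
  have φne : ∀ {v}, v ≠ z → φ v = v := fun hv => if_neg hv
  have φnz : ∀ v, φ v ≠ z := by
    intro v
    by_cases hv : v = z
    · rw [hv, φz]; exact hzy.ne'
    · rwa [φne hv]
  have lift : ∀ a b, (G.contractInto z y).Adj a b →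
      ∃ a' b', φ a' = a ∧ φ b' = b ∧ G.Adj a' b' := by
    rintro a b ⟨-, ha, hb, h | ⟨rfl, h⟩ | ⟨rfl, h⟩⟩
    exacts [⟨a, b, φne ha, φne hb, h⟩, ⟨z, b, φz, φne hb, h⟩, ⟨a, z, φne ha, φz, h.symm⟩]
  have fib : ∀ i (a b : V) (ha : φ a ∈ S i) (hb : φ b ∈ S i), φ a = φ b →
      (G.induce (φ ⁻¹' S i)).Reachable ⟨a, ha⟩ ⟨b, hb⟩ := by
    intro i a b ha hb hab
    by_cases hz : a = z <;> by_cases hz' : b = z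
    · subst hz; subst hz'; rfl
    · subst hz
      rw [φz, φne hz'] at hab
      subst hab
      exact Adj.reachable (by simpa using hzy)
    · subst hz'
      rw [φz, φne hz] at hab
      subst hab
      exact Adj.reachable (by simpa using hzy.symm)
    · rw [φne hz, φne hz'] at hab
      subst hab; rfl
  refine ⟨fun i => φ ⁻¹' S i, fun i => ?_, fun i => ?_, fun i j hij => ?_, fun i j hij => ?_⟩
  · obtain ⟨j, hj⟩ := exists_ne i
    obtain ⟨a, ha, b, -, hab⟩ := hadj hj.symm
    exact ⟨a, by simpa [φne hab.2.1] using ha⟩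
  · have walk : ∀ (p q : S i), ((G.contractInto z y).induce (S i)).Walk p q →
        ∀ (a b : V) (ha : φ a ∈ S i) (hb : φ b ∈ S i), φ a = p → φ b = q →
          (G.induce (φ ⁻¹' S i)).Reachable ⟨a, ha⟩ ⟨b, hb⟩ := by
      intro p q w
      induction w with
      | nil => exact fun a b ha hb hap hbp => fib i a b ha hb (hap.trans hbp.symm)
      | @cons p r q hpr w ih =>
        intro a b ha hb hap hbq
        obtain ⟨a', r', ha', hr', har⟩ := lift _ _ hpr
        have ha'S : φ a' ∈ S i := by rw [ha']; exact p.2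
        have hr'S : φ r' ∈ S i := by rw [hr']; exact r.2
        have step : (G.induce (φ ⁻¹' S i)).Adj ⟨a', ha'S⟩ ⟨r', hr'S⟩ := har
        exact (fib i a a' ha ha'S (hap.trans ha'.symm)).trans
          (step.reachable.trans (ih r' b hr'S hb hr' hbq))
    obtain ⟨j, hj⟩ := exists_ne i
    obtain ⟨a, ha, b, -, hab⟩ := hadj hj.symm
    refine (connected_iff _).2 ⟨?_, ⟨a, by simpa [φne hab.2.1] using ha⟩⟩
    rintro ⟨p, hp⟩ ⟨q, hq⟩
    obtain ⟨w⟩ := (hconn i).preconnected ⟨φ p, hp⟩ ⟨φ q, hq⟩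
    exact walk _ _ w p q hp hq rfl rfl
  · exact (hdisj hij).preimage φ
  · obtain ⟨a, ha, b, hb, hab⟩ := hadj hij
    obtain ⟨a', b', rfl, rfl, h⟩ := lift a b hab
    exact ⟨a', ha, b', hb, h⟩

theorem hasK4Minor_of_adj {G : SimpleGraph V} {a b c d : V} (hab : G.Adj a b) (hac : G.Adj a c)
    (had : G.Adj a d) (hbc : G.Adj b c) (hbd : G.Adj b d) (hcd : G.Adj c d) : HasK4Minor G := by
  have key : Pairwise fun i j => G.Adj (![a, b, c, d] i) (![a, b, c, d] j) := by
    intro i j hij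
    fin_cases i <;> fin_cases j <;> first | exact absurd rfl hij | skip
    exacts [hab, hac, had, hab.symm, hbc, hbd, hac.symm, hbc.symm, hcd, had.symm, hbd.symm,
      hcd.symm]
  refine ⟨fun i => {![a, b, c, d] i}, fun i => Set.singleton_nonempty _, fun i => ?_,
    fun i j hij => ?_, fun i j hij => ⟨_, rfl, _, rfl, key hij⟩⟩
  · exact (connected_iff _).2 ⟨Preconnected.of_subsingleton, ⟨_, rfl⟩⟩
  · exact Set.disjoint_singleton.2 (key hij).ne

/-- A finite graph with an edge in which every non-isolated vertex has degree at least `3`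
has a `K₄` minor. -/
theorem hasK4Minor_of_three_le_degree [Finite V] (G : SimpleGraph V) (hne : ∃ v w, G.Adj v w)
    (hG : ∀ v w, G.Adj v w → ∀ a b, ∃ c, G.Adj v c ∧ c ≠ a ∧ c ≠ b) : HasK4Minor G := by
  induction hn : G.support.ncard using Nat.strong_induction_on generalizing G with
  | _ n ih =>
  subst hn
  by_contra hK
  have descend : ∀ H : SimpleGraph V, ∀ z y, G.Adj z y → H ≤ G.contractInto z y →
      (∃ v w, H.Adj v w) → ¬ ∀ v w, H.Adj v w → ∀ a b, ∃ c, H.Adj v c ∧ c ≠ a ∧ c ≠ b := by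
    intro H z y hzy hle hH hdeg
    have hlt := Set.ncard_lt_ncard
      ((support_mono hle).trans_ssubset (support_contractInto_ssubset hzy))
    exact hK (((ih _ hlt H hH hdeg rfl).mono hle).of_contractInto hzy)
  have common : ∀ z y, G.Adj z y → ∃ c, G.Adj z c ∧ G.Adj y c := by
    intro z y hzy
    by_contra! hno
    obtain ⟨c, hzc, hcy, hcz⟩ := hG z y hzy y z
    refine descend _ z y hzy le_rfl
      ⟨y, c, hcy.symm, hzy.ne', hzc.ne', Or.inr (Or.inl ⟨rfl, hzc⟩)⟩ ?_
    intro v w hvw a b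
    have hvG : ∃ w, G.Adj v w := by
      obtain ⟨-, -, -, h | ⟨rfl, -⟩ | ⟨-, h⟩⟩ := hvw
      exacts [⟨w, h⟩, ⟨z, hzy.symm⟩, ⟨z, h.symm⟩]
    obtain ⟨w', hvw'⟩ := hvG
    have hvz : v ≠ z := hvw.2.1
    have hv := hG v w' hvw'
    simp only [contractInto_adj]
    by_cases hvy : v = y
    · subst hvy
      obtain ⟨c, hzc, hcv, hca⟩ := hG z v hzy v a
      obtain ⟨d, hvd, hdz, hda⟩ := hv z a
      have := hno c hzc
      have := hzc.ne
      have := hvd.ne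
      by_cases hcb : c = b
      · exact ⟨d, by grind⟩
      · exact ⟨c, by grind⟩
    · by_cases hzv : G.Adj z v
      · obtain ⟨c, hvc, hca, hcb⟩ := hv a b
        obtain ⟨d, hvd, hdz, hda⟩ := hv z a
        obtain ⟨e, hve, hez, heb⟩ := hv z b
        have hyv := hno v hzv
        have := hvc.ne
        have := hvd.ne
        have := hve.ne
        have := hzy.ne
        have hdy : d ≠ y := by rintro rfl; exact hyv hvd.symm
        have hey : e ≠ y := by rintro rfl; exact hyv hve.symm
        by_cases hcz : c = z
        · by_cases hya : y = a
          · exact ⟨e, by grind⟩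
          · by_cases hyb : y = b
            · exact ⟨d, by grind⟩
            · exact ⟨y, by grind⟩
        · exact ⟨c, by grind⟩
      · obtain ⟨c, hvc, hca, hcb⟩ := hv a b
        have : c ≠ z := by rintro rfl; exact hzv hvc.symm
        exact ⟨c, ⟨hvc.ne, hvz, this, Or.inl hvc⟩, hca, hcb⟩
  have cubic : ∃ z w x y t, G.Adj z w ∧ ∀ c, G.Adj z c → c = x ∨ c = y ∨ c = t := by
    by_contra! hno
    obtain ⟨z, y, hzy⟩ := hne
    obtain ⟨c, hyc, hcz, -⟩ := hG y z hzy.symm z z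
    refine descend _ z y hzy le_rfl ⟨y, c, hyc.ne, hzy.ne', hcz, Or.inl hyc⟩ ?_
    intro v w hvw a b
    have hvG : ∃ w, G.Adj v w := by
      obtain ⟨-, -, -, h | ⟨rfl, -⟩ | ⟨-, h⟩⟩ := hvw
      exacts [⟨w, h⟩, ⟨z, hzy.symm⟩, ⟨z, h.symm⟩]
    obtain ⟨w', hvw'⟩ := hvG
    obtain ⟨d, hvd, hdz, hda, hdb⟩ := hno v w' z a b hvw'
    exact ⟨d, ⟨hvd.ne, hvw.2.1, hdz, Or.inl hvd⟩, hda, hdb⟩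
  have core : ∀ z x y t, (∀ c, G.Adj z c → c = x ∨ c = y ∨ c = t) → G.Adj z x → G.Adj z y →
      G.Adj z t → y ≠ t → G.Adj x y → G.Adj x t → False := by
    intro z x y t hz hzx hzy hzt hyt hxy hxt
    have nyt : ¬ G.Adj y t := fun h => hK (hasK4Minor_of_adj hzx hzy hzt hxy hxt h)
    have hxz := hzx.ne
    have hyz := hzy.ne
    have htz := hzt.ne
    have hyx := hxy.ne
    have htx := hxt.ne
    have symm : ∀ {a b}, G.Adj a b → G.Adj b a := fun h => h.symm
    have hx : ∀ c, G.Adj x c → c = z ∨ c = y ∨ c = t := by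
      by_contra! hno
      obtain ⟨s, hxs, hsz, hsy, hst⟩ := hno
      refine descend _ z y hzy le_rfl
        ⟨y, t, hyt, hyz.symm, htz.symm, Or.inr (Or.inl ⟨rfl, hzt⟩)⟩ ?_
      intro v w hvw a b
      have hvz : v ≠ z := hvw.2.1
      have end_case : ∀ u u', (u = y ∧ u' = t ∨ u = t ∧ u' = y) →
          ∃ c, (G.contractInto z y).Adj u c ∧ c ≠ a ∧ c ≠ b := by
        intro u u' huu'
        have hzu : G.Adj z u := by grind
        have nuu' : ¬ G.Adj u u' := by grind
        have adj' : (G.contractInto z y).Adj u u' := by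
          rw [contractInto_adj]; grind
        have adj : ∀ c, c ≠ z → G.Adj u c → (G.contractInto z y).Adj u c :=
          fun c hc h => ⟨h.ne, hzu.ne', hc, Or.inl h⟩
        obtain ⟨c, hc⟩ := hG u z hzu.symm a b
        obtain ⟨d, hd⟩ := hG u z hzu.symm z a
        obtain ⟨e, he⟩ := hG u z hzu.symm z b
        grind
      by_cases hvy : v = y
      · exact end_case v t (by grind)
      by_cases hvt : v = t
      · exact end_case v y (by grind)
      by_cases hvx : v = x
      · subst hvx
        have adj : ∀ c, c ≠ z → G.Adj v c → (G.contractInto z y).Adj v c :=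
          fun c hc h => ⟨h.ne, hvz, hc, Or.inl h⟩
        grind
      · have nzv : ¬ G.Adj z v := by grind
        have hvG : G.Adj v w := by
          rw [contractInto_adj] at hvw; grind
        obtain ⟨c, hvc, hc⟩ := hG v w hvG a b
        exact ⟨c, ⟨hvc.ne, hvz, by rintro rfl; exact nzv hvc.symm, Or.inl hvc⟩, hc⟩
    have not_cubic : ∀ u u', (u = y ∧ u' = t ∨ u = t ∧ u' = y) →
        ∀ a b c, ∃ d, G.Adj u d ∧ d ≠ a ∧ d ≠ b ∧ d ≠ c := by
      intro u u' huu' a b c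
      by_contra! hno
      have hzu : G.Adj z u := by grind
      have hxu : G.Adj x u := by grind
      have nuu' : ¬ G.Adj u u' := by grind
      obtain ⟨s, hus, hsz, hsx⟩ := hG u z hzu.symm z x
      obtain ⟨d, hud, hsd⟩ := common u s hus
      have hd : d = z ∨ d = x := by
        have := hno z (symm hzu)
        have := hno x (symm hxu)
        have := hno s hus
        have := hno d hud
        have := hsd.ne
        clear hno common cubic hG ih descend hz hx symm
        grind +splitImp
      have := hus.ne
      rcases hd with rfl | rfl
      · have := hz s hsd.symm
        grind
      · have := hx s hsd.symm
        grind
    let H := (G.contractInto z y).deleteIncidenceSet x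
    have hHadj : ∀ {a b}, H.Adj a b ↔ (G.contractInto z y).Adj a b ∧ a ≠ x ∧ b ≠ x :=
      fun {a b} => deleteIncidenceSet_adj
    have hyt' : H.Adj y t := by
      rw [hHadj, contractInto_adj]; grind
    refine descend H z y hzy (deleteIncidenceSet_le _ _) ⟨y, t, hyt'⟩ ?_
    intro v w hvw a b
    have hvw' := hvw
    rw [hHadj, contractInto_adj] at hvw'
    have adj : ∀ c, c ≠ z → c ≠ x → G.Adj v c → H.Adj v c :=
      fun c hc hcx h => hHadj.2 ⟨⟨h.ne, hvw'.1.2.1, hc, Or.inl h⟩, hvw'.2.1, hcx⟩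
    have end_case : ∀ u', (v = y ∧ u' = t ∨ v = t ∧ u' = y) →
        ∃ c, H.Adj v c ∧ c ≠ a ∧ c ≠ b := by
      intro u' huu'
      have adj' : H.Adj v u' := by
        rcases huu' with ⟨rfl, rfl⟩ | ⟨rfl, rfl⟩
        exacts [hyt', hyt'.symm]
      have nuu' : ¬ G.Adj v u' := by grind
      obtain ⟨d, hd⟩ := not_cubic v u' huu' z x a
      obtain ⟨e, he⟩ := not_cubic v u' huu' z x b
      grind
    by_cases hvy : v = y
    · exact end_case t (by grind)
    by_cases hvt : v = t
    · exact end_case y (by grind)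
    have nzv : ¬ G.Adj z v := by grind
    have nxv : ¬ G.Adj x v := by grind
    have hvG : G.Adj v w := by grind
    obtain ⟨c, hvc, hc⟩ := hG v w hvG a b
    exact ⟨c, adj c (by rintro rfl; exact nzv hvc.symm) (by rintro rfl; exact nxv hvc.symm) hvc, hc⟩
  obtain ⟨z, w, x, y, t, hzw, hz⟩ := cubic
  have hdeg := hG z w hzw
  obtain ⟨t', ht'⟩ := hdeg x y
  obtain ⟨y', hy'⟩ := hdeg x t
  obtain ⟨x', hx'⟩ := hdeg y t
  obtain rfl : t' = t := by grind
  obtain rfl : y' = y := by grind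
  obtain rfl : x' = x := by grind
  obtain ⟨a, hza, hxa⟩ := common z x' hx'.1
  obtain ⟨b, hzb, hyb⟩ := common z y' hy'.1
  obtain ⟨c, hzc, htc⟩ := common z t' ht'.1
  have := hxa.ne
  have := hyb.ne
  have := htc.ne
  have c1 := core z x' y' t' (by grind) hx'.1 hy'.1 ht'.1 (by grind)
  have c2 := core z y' x' t' (by grind) hy'.1 hx'.1 ht'.1 (by grind)
  have c3 := core z t' x' y' (by grind) ht'.1 hx'.1 hy'.1 (by grind)
  have symm : ∀ {a b}, G.Adj a b → G.Adj b a := fun h => h.symm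
  grind

/-- Two vertices of `C₈⁺⁺` are related with parameter `true` if they are adjacent, and with
parameter `false` if they are at distance two. -/
def C8ppRel (p : Bool) (i j : ZMod 8) : Prop :=
  if p then C8pp.Adj i j else i ≠ j ∧ ¬ C8pp.Adj i j ∧ ∃ k, C8pp.Adj i k ∧ C8pp.Adj k j

instance : DecidableRel C8pp.Adj := fun a b =>
  inferInstanceAs (Decidable (a ≠ b ∧ ((b = a + 1 ∨ (a = 0 ∧ b = 4) ∨ (a = 2 ∧ b = 6)) ∨
    (a = b + 1 ∨ (b = 0 ∧ a = 4) ∨ (b = 2 ∧ a = 6)))))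

instance (p : Bool) : DecidableRel (C8ppRel p) := fun i j => by
  unfold C8ppRel; infer_instance

theorem C8ppRel.symm {p : Bool} {i j : ZMod 8} (h : C8ppRel p i j) : C8ppRel p j i := by
  revert p i j; decide

theorem C8ppRel.exists_left (p : Bool) (i : ZMod 8) : ∃ k, C8ppRel p k i := by
  revert p i; decide

theorem C8ppRel.exists_triangle {p q r : Bool} {i j : ZMod 8} (h : C8ppRel p i j)
    (hpqr : ¬ (p = true ∧ q = true ∧ r = true)) : ∃ k, C8ppRel q k i ∧ C8ppRel r k j := by
  revert p q r i j; decide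

open Classical in
/-- Given a triangle-free graph `G₀`, every `K₄`-minor-free graph `G` maps to `C₈⁺⁺` so that
its edges in `G₀` go to edges and its other edges go to pairs at distance two. -/
theorem exists_map_C8ppRel [Finite V] (G₀ : SimpleGraph V)
    (h₀ : ∀ a b c, G₀.Adj a b → G₀.Adj b c → ¬ G₀.Adj c a) (G : SimpleGraph V)
    (hG : ¬ HasK4Minor G) :
    ∃ f : V → ZMod 8, ∀ a b, G.Adj a b → C8ppRel (decide (G₀.Adj a b)) (f a) (f b) := by
  induction hn : G.support.ncard using Nat.strong_induction_on generalizing G with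
  | _ n ih =>
  subst hn
  by_cases hne : ∃ v w, G.Adj v w
  swap
  · exact ⟨fun _ => 0, fun a b h => (hne ⟨a, b, h⟩).elim⟩
  have hlow := mt (hasK4Minor_of_three_le_degree G hne) hG
  push Not at hlow
  obtain ⟨v, w, hvw, a, b, hab⟩ := hlow
  obtain ⟨f, hf⟩ := ih _ (Set.ncard_lt_ncard (support_contractInto_ssubset hvw)) _
    (fun h => hG (h.of_contractInto hvw)) rfl
  obtain ⟨k, hk⟩ : ∃ k, ∀ u, G.Adj v u → C8ppRel (decide (G₀.Adj v u)) k (f u) := by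
    by_cases hu : ∃ u, G.Adj v u ∧ u ≠ w
    · obtain ⟨u, hvu, huw⟩ := hu
      have hwu := hf w u ⟨huw.symm, hvw.ne', hvu.ne', Or.inr (Or.inl ⟨rfl, hvu⟩)⟩
      obtain ⟨k, hkw, hku⟩ := hwu.exists_triangle (q := decide (G₀.Adj v w))
        (r := decide (G₀.Adj v u)) (by
          simp only [decide_eq_true_eq]
          exact fun h => h₀ _ _ _ h.2.1 h.1 h.2.2.symm)
      refine ⟨k, fun u' hu' => ?_⟩
      have : u' = w ∨ u' = u := by grind +splitImp
      rcases this with rfl | rfl <;> assumption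
    · obtain ⟨k, hk⟩ := C8ppRel.exists_left (decide (G₀.Adj v w)) (f w)
      refine ⟨k, fun u' hu' => ?_⟩
      obtain rfl : u' = w := by_contra fun h => hu ⟨u', hu', h⟩
      exact hk
  refine ⟨Function.update f v k, fun c d hcd => ?_⟩
  by_cases hc : c = v
  · subst hc
    rw [Function.update_self, Function.update_of_ne hcd.ne']
    exact hk d hcd
  by_cases hd : d = v
  · subst hd
    rw [Function.update_self, Function.update_of_ne hc]
    simpa only [G₀.adj_comm] using (hk c hcd.symm).symm
  · rw [Function.update_of_ne hc, Function.update_of_ne hd]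
    exact hf c d ⟨hcd.ne, hc, hd, Or.inl hcd⟩

theorem not_adj_of_oddGirthAtLeast_five {G : SimpleGraph V} (h : oddGirthAtLeast G 5) {a b c : V}
    (hab : G.Adj a b) (hbc : G.Adj b c) : ¬ G.Adj c a := by
  intro hca
  have := h a (.cons hab (.cons hbc (.cons hca .nil))) (by
    have := hab.ne
    have := hbc.ne
    have := hca.ne
    simp [Walk.isCycle_def, Walk.isTrail_def]
    grind) ⟨1, rfl⟩
  simp at this

end SimpleGraph

/-- Every finite `K₄`-minor-free graph of odd-girth at least `5` admits a
homomorphism to `C₈⁺⁺`. -/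
theorem SP5_to_C8pp {V : Type*} [Fintype V] (G : SimpleGraph V)
    (h1 : ¬ HasK4Minor G) (h2 : oddGirthAtLeast G 5) :
    Nonempty (G →g C8pp) := by
  obtain ⟨f, hf⟩ := exists_map_C8ppRel G (fun _ _ _ => not_adj_of_oddGirthAtLeast_five h2) G h1
  exact ⟨⟨f, fun {a b} h => by simpa [C8ppRel, h] using hf a b h⟩⟩
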